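/- arXiv:1210.3791 — 8 statements merged into one kernel-verified Lean document; each statement's English description precedes it below -/
import Mathlib

section
/- For every C ∈ (0,1] and λ > 0 there exist L > 0 and σ ∈ (0, λ) such that: every continuous function φ : ℝ → (0,∞) satisfying φ(s+u) ≥ C² e^{2λu} φ(s) for all s ∈ ℝ and all u ≥ 0 also satisfies ∫_t^{t+L} φ(s) ds ≥ e^{2σt} ∫_0^L φ(s) ds for every t ≥ 0. -/
/-- A sliding-window integral of a continuous function is differentiable in the window's
starting point. -/
theorem hasDerivAt_integral_window {φ : ℝ → ℝ} (hφ : Continuous φ) (L t : ℝ) :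
    HasDerivAt (fun x => ∫ s in x..(x + L), φ s) (φ (t + L) - φ t) t := by
  have hG (x : ℝ) : HasDerivAt (fun y => ∫ s in (0 : ℝ)..y, φ s) (φ x) x :=
    intervalIntegral.integral_hasDerivAt_right (hφ.intervalIntegrable _ _)
      (hφ.stronglyMeasurableAtFilter _ _) hφ.continuousAt
  refine (((hG (t + L)).comp_add_const t L).sub (hG t)).congr_of_eventuallyEq
    (Filter.Eventually.of_forall fun x => ?_)
  exact (intervalIntegral.integral_interval_sub_left
    (hφ.intervalIntegrable _ _) (hφ.intervalIntegrable _ _)).symm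

/-- A function with `F' ≥ a F` grows at least like `exp (a t)`. -/
theorem exp_mul_le_of_hasDerivAt_of_mul_le {F F' : ℝ → ℝ} {a : ℝ}
    (hF : ∀ x, HasDerivAt F (F' x) x) (h : ∀ x, a * F x ≤ F' x) {t : ℝ} (ht : 0 ≤ t) :
    Real.exp (a * t) * F 0 ≤ F t := by
  have hderiv (x : ℝ) : HasDerivAt (fun y => Real.exp (-(a * y)) * F y)
      (Real.exp (-(a * x)) * (F' x - a * F x)) x := by
    have hexp : HasDerivAt (fun y => Real.exp (-(a * y))) (Real.exp (-(a * x)) * -(a * 1)) x :=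
      ((hasDerivAt_id x).const_mul a).neg.exp
    exact (hexp.mul (hF x)).congr_deriv (by ring)
  have hmono : Monotone fun y => Real.exp (-(a * y)) * F y :=
    monotone_of_hasDerivAt_nonneg hderiv fun x =>
      mul_nonneg (Real.exp_pos _).le (sub_nonneg.2 (h x))
  have h0 : F 0 ≤ Real.exp (-(a * t)) * F t := by simpa using hmono ht
  calc Real.exp (a * t) * F 0 ≤ Real.exp (a * t) * (Real.exp (-(a * t)) * F t) := by gcongr
    _ = F t := by rw [← mul_assoc, ← Real.exp_add]; simp

/-- For every `C ∈ (0,1]` and `λ > 0` there exist `L > 0` and `σ ∈ (0, λ)`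
such that every continuous positive function `φ` with `φ(s+u) ≥ C² e^{2λu} φ(s)`
for all `s ∈ ℝ`, `u ≥ 0` satisfies `∫_t^{t+L} φ ≥ e^{2σt} ∫_0^L φ` for every `t ≥ 0`. -/
theorem adapted_metric_unstable_core :
    ∀ C : ℝ, C ∈ Set.Ioc (0 : ℝ) 1 → ∀ lam : ℝ, 0 < lam →
      ∃ L : ℝ, 0 < L ∧ ∃ σ : ℝ, σ ∈ Set.Ioo 0 lam ∧
        ∀ φ : ℝ → ℝ, Continuous φ → (∀ s, 0 < φ s) →
          (∀ s : ℝ, ∀ u : ℝ, 0 ≤ u → C ^ 2 * Real.exp (2 * lam * u) * φ s ≤ φ (s + u)) →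
          ∀ t : ℝ, 0 ≤ t →
            Real.exp (2 * σ * t) * (∫ s in (0:ℝ)..L, φ s) ≤ ∫ s in t..(t + L), φ s := by
  rintro C ⟨hC, hC1⟩ lam hlam
  refine ⟨1 / (lam * C ^ 2), by positivity, lam * C ^ 4 / 4, ⟨by positivity, ?_⟩, ?_⟩
  · have : C ^ 4 ≤ 1 := pow_le_one₀ hC.le hC1
    nlinarith
  intro φ hφ hpos hgrow t ht
  set L := 1 / (lam * C ^ 2) with hL
  have hL0 : 0 < L := by positivity
  have hrate (x : ℝ) :
      2 * (lam * C ^ 4 / 4) * (∫ s in x..(x + L), φ s) ≤ φ (x + L) - φ x := by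
    have hexp : 2 ≤ C ^ 2 * Real.exp (2 * lam * L) := by
      have h2 : C ^ 2 * (2 * lam * L) = 2 := by rw [hL]; field_simp
      nlinarith [Real.add_one_le_exp (2 * lam * L), sq_nonneg C]
    have hend : 2 * φ x ≤ φ (x + L) :=
      (mul_le_mul_of_nonneg_right hexp (hpos x).le).trans (hgrow x L hL0.le)
    have hbound : ∀ s ∈ Set.Icc x (x + L), φ s ≤ φ (x + L) / C ^ 2 := by
      intro s hs
      have hu : 0 ≤ x + L - s := sub_nonneg.2 hs.2
      have h1 : 1 ≤ Real.exp (2 * lam * (x + L - s)) := Real.one_le_exp (by positivity)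
      have hg := hgrow s (x + L - s) hu
      rw [add_sub_cancel] at hg
      rw [le_div_iff₀ (by positivity)]
      nlinarith [mul_le_mul_of_nonneg_left h1 (mul_pos (hpos s) (pow_pos hC 2)).le]
    have hint : (∫ s in x..(x + L), φ s) ≤ L * (φ (x + L) / C ^ 2) := by
      calc (∫ s in x..(x + L), φ s) ≤ ∫ _ in x..(x + L), φ (x + L) / C ^ 2 :=
            intervalIntegral.integral_mono_on (by linarith) (hφ.intervalIntegrable _ _)
              intervalIntegrable_const hbound
        _ = L * (φ (x + L) / C ^ 2) := by
            rw [intervalIntegral.integral_const, add_sub_cancel_left, smul_eq_mul]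
    calc 2 * (lam * C ^ 4 / 4) * (∫ s in x..(x + L), φ s)
        ≤ 2 * (lam * C ^ 4 / 4) * (L * (φ (x + L) / C ^ 2)) := by gcongr
      _ = φ (x + L) / 2 := by rw [hL]; field_simp; norm_num
      _ ≤ φ (x + L) - φ x := by linarith
  simpa using exp_mul_le_of_hasDerivAt_of_mul_le (hasDerivAt_integral_window hφ L) hrate ht
end

section
/- For every C ∈ (0,1] and λ > 0 there exist L > 0 and σ ∈ (0, λ) such that: every continuous function φ : ℝ → (0,∞) satisfying φ(s−u) ≥ C² e^{2λu} φ(s) for all s ∈ ℝ and all u ≥ 0 also satisfies ∫_{−t}^{−t+L} φ(s) ds ≥ e^{2σt} ∫_0^L φ(s) ds for every t ≥ 0. -/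
open intervalIntegral in
/-- Exponential backward growth bounds the integral of `φ` over `[a, a + L]` by the value `φ a`. -/
theorem integral_le_of_exp_backward_growth {φ : ℝ → ℝ} (hφ : Continuous φ) {c μ a L : ℝ}
    (hμ : 0 < μ) (hL : 0 ≤ L) (ha : 0 ≤ φ a)
    (h : ∀ s u : ℝ, 0 ≤ u → c * Real.exp (μ * u) * φ s ≤ φ (s - u)) :
    μ * c * ∫ s in a..(a + L), φ s ≤ φ a := by
  have hderiv : ∀ s : ℝ, HasDerivAt (fun s => -Real.exp (-μ * (s - a)) * φ a)
      (μ * Real.exp (-μ * (s - a)) * φ a) s := by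
    intro s
    have h1 : HasDerivAt (fun s : ℝ => -μ * (s - a)) (-μ * 1) s :=
      ((hasDerivAt_id s).sub_const a).const_mul (-μ)
    exact (h1.exp.neg.mul_const (φ a)).congr_deriv (by ring)
  have hcont : Continuous fun s : ℝ => μ * Real.exp (-μ * (s - a)) * φ a := by fun_prop
  have hle : ∫ s in a..(a + L), μ * c * φ s ≤
      ∫ s in a..(a + L), μ * Real.exp (-μ * (s - a)) * φ a := by
    refine integral_mono_on (by linarith) ((hφ.const_mul _).intervalIntegrable _ _)
      (hcont.intervalIntegrable _ _) fun s hs => ?_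
    have hgrowth := h s (s - a) (by linarith [hs.1])
    rw [sub_sub_cancel] at hgrowth
    have hexp : Real.exp (-μ * (s - a)) * Real.exp (μ * (s - a)) = 1 := by
      rw [← Real.exp_add]; simp
    calc μ * c * φ s
        = μ * Real.exp (-μ * (s - a)) * (c * Real.exp (μ * (s - a)) * φ s) := by
          linear_combination (-μ * c * φ s) * hexp
      _ ≤ _ := by gcongr
  rw [integral_const_mul, integral_eq_sub_of_hasDerivAt (fun s _ => hderiv s)
    (hcont.intervalIntegrable _ _)] at hle
  have : 0 ≤ Real.exp (-μ * (a + L - a)) * φ a := by positivity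
  simp only [sub_self, mul_zero, Real.exp_zero] at hle
  linarith

/-- The derivative of the integral of `φ` over a window of length `L` sliding backwards. -/
theorem hasDerivAt_integral_backward_window {φ : ℝ → ℝ} (hφ : Continuous φ) (L t : ℝ) :
    HasDerivAt (fun t => ∫ s in (-t)..(-t + L), φ s) (φ (-t) - φ (-t + L)) t := by
  have hP : ∀ x, HasDerivAt (fun x => ∫ s in (0 : ℝ)..x, φ s) (φ x) x := fun x =>
    intervalIntegral.integral_hasDerivAt_right (hφ.intervalIntegrable _ _)
      (hφ.stronglyMeasurableAtFilter _ _) hφ.continuousAt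
  have h1 : HasDerivAt (fun t : ℝ => -t) (-1) t := hasDerivAt_neg t
  have h2 := ((hP (-t + L)).comp t (h1.add_const L)).sub ((hP (-t)).comp t h1)
  refine (h2.congr_deriv (by ring)).congr_of_eventuallyEq (.of_forall fun x => ?_)
  exact (intervalIntegral.integral_interval_sub_left (hφ.intervalIntegrable _ _)
    (hφ.intervalIntegrable _ _)).symm

/-- A differential inequality `k * F ≤ F'` forces exponential growth at rate `k`. -/
theorem exp_mul_le_of_mul_le_deriv {F F' : ℝ → ℝ} {k : ℝ} (hF : ∀ t, HasDerivAt F (F' t) t)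
    (h : ∀ t, k * F t ≤ F' t) {t : ℝ} (ht : 0 ≤ t) : Real.exp (k * t) * F 0 ≤ F t := by
  have hderiv : ∀ x, HasDerivAt (fun x => Real.exp (-k * x) * F x)
      (Real.exp (-k * x) * (F' x - k * F x)) x := by
    intro x
    have h1 : HasDerivAt (fun x : ℝ => -k * x) (-k * 1) x := (hasDerivAt_id x).const_mul (-k)
    exact (h1.exp.mul (hF x)).congr_deriv (by ring)
  have hmono := monotone_of_hasDerivAt_nonneg hderiv fun x =>
    mul_nonneg (Real.exp_pos _).le (sub_nonneg.2 (h x))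
  have hle : F 0 ≤ Real.exp (-k * t) * F t := by simpa using hmono ht
  have hexp : Real.exp (k * t) * Real.exp (-k * t) = 1 := by
    rw [← Real.exp_add]; simp
  calc Real.exp (k * t) * F 0 ≤ Real.exp (k * t) * (Real.exp (-k * t) * F t) := by gcongr
    _ = F t := by rw [← mul_assoc, hexp, one_mul]

/-- For every `C ∈ (0,1]` and `λ > 0` there exist `L > 0` and `σ ∈ (0, λ)`
such that every continuous positive function `φ` with `φ(s−u) ≥ C² e^{2λu} φ(s)`
for all `s ∈ ℝ`, `u ≥ 0` satisfies `∫_{−t}^{−t+L} φ ≥ e^{2σt} ∫_0^L φ` for every `t ≥ 0`. -/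
theorem adapted_metric_stable_core :
    ∀ C : ℝ, C ∈ Set.Ioc (0 : ℝ) 1 → ∀ lam : ℝ, 0 < lam →
      ∃ L : ℝ, 0 < L ∧ ∃ σ : ℝ, σ ∈ Set.Ioo 0 lam ∧
        ∀ φ : ℝ → ℝ, Continuous φ → (∀ s, 0 < φ s) →
          (∀ s : ℝ, ∀ u : ℝ, 0 ≤ u → C ^ 2 * Real.exp (2 * lam * u) * φ s ≤ φ (s - u)) →
          ∀ t : ℝ, 0 ≤ t →
            Real.exp (2 * σ * t) * (∫ s in (0:ℝ)..L, φ s) ≤ ∫ s in (-t)..(-t + L), φ s := by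
  intro C ⟨hC, hC1⟩ lam hlam
  have hCsq : C ^ 2 ≤ 1 := pow_le_one₀ hC.le hC1
  have hCpos : 0 < C ^ 2 := by positivity
  have hratio : 1 < 2 / C ^ 2 := by rw [lt_div_iff₀ hCpos]; linarith
  have hL : 0 < Real.log (2 / C ^ 2) / (2 * lam) := div_pos (Real.log_pos hratio) (by positivity)
  refine ⟨Real.log (2 / C ^ 2) / (2 * lam), hL, lam * C ^ 2 / 2, ⟨by positivity, by nlinarith⟩, ?_⟩
  intro φ hφ hpos h t ht
  have hK : C ^ 2 * Real.exp (2 * lam * (Real.log (2 / C ^ 2) / (2 * lam))) = 2 := by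
    rw [mul_div_cancel₀ _ (by positivity), Real.exp_log (by positivity)]
    field_simp
  generalize Real.log (2 / C ^ 2) / (2 * lam) = L at hL hK ⊢
  have key := exp_mul_le_of_mul_le_deriv (k := 2 * (lam * C ^ 2 / 2))
    (hasDerivAt_integral_backward_window hφ L) (fun x => ?_) ht
  · simpa using key
  · have hint := integral_le_of_exp_backward_growth hφ (by positivity) hL.le (hpos (-x)).le h
    have hend := h (-x + L) L hL.le
    rw [hK, add_sub_cancel_right] at hend
    linarith
end

section
/- One has ∫_{aL}^{L} φ(s) ds ≥ β ∫_0^L φ(s) ds, where β := C² e^{2λ(1−a)L}(1−a) / (a + (1−a)C² e^{2λ(1−a)L}). -/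
/-- `∫_{aL}^{L} φ(s) ds ≥ β ∫_0^L φ(s) ds`, where
`β := C² e^{2λ(1−a)L}(1−a) / (a + (1−a)C² e^{2λ(1−a)L})`, for a continuous positive
function `φ` satisfying `φ(s+u) ≥ C² e^{2λu} φ(s)` for all `s ∈ ℝ`, `u ≥ 0`. -/
theorem tail_integral_lower_bound
    (C lam L a : ℝ)
    (hC : C ∈ Set.Ioc (0 : ℝ) 1) (hlam : 0 < lam) (hL : 0 < L)
    (ha : a ∈ Set.Ioo (1/2 : ℝ) 1)
    (φ : ℝ → ℝ) (hφc : Continuous φ) (hφpos : ∀ s, 0 < φ s)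
    (hgrowth : ∀ s : ℝ, ∀ u : ℝ, 0 ≤ u → C ^ 2 * Real.exp (2 * lam * u) * φ s ≤ φ (s + u)) :
    (C ^ 2 * Real.exp (2 * lam * (1 - a) * L) * (1 - a)
        / (a + (1 - a) * C ^ 2 * Real.exp (2 * lam * (1 - a) * L)))
      * (∫ s in (0:ℝ)..L, φ s) ≤ ∫ s in (a * L)..L, φ s := by
  obtain ⟨ha1, ha2⟩ := ha
  have hC0 : 0 < C := hC.1
  have ha0 : 0 < a := by linarith
  have hb0 : 0 < 1 - a := by linarith
  set K : ℝ := C ^ 2 * Real.exp (2 * lam * (1 - a) * L) with hK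
  have hKpos : 0 < K := by positivity
  have hhead : a * ∫ r in (0:ℝ)..L, φ (a * r) = ∫ s in (0:ℝ)..(a * L), φ s := by
    simp
  have htail : (1 - a) * ∫ r in (0:ℝ)..L, φ (a * L + (1 - a) * r) = ∫ s in (a * L)..L, φ s := by
    have h := intervalIntegral.mul_integral_comp_add_mul (a := 0) (b := L) (f := φ) (1 - a) (a * L)
    rw [h]
    congr 1 <;> ring
  have hcompare : K * ∫ r in (0:ℝ)..L, φ (a * r) ≤ ∫ r in (0:ℝ)..L, φ (a * L + (1 - a) * r) := by
    rw [← intervalIntegral.integral_const_mul]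
    refine intervalIntegral.integral_mono_on hL.le
      (Continuous.intervalIntegrable (by fun_prop) _ _)
      (Continuous.intervalIntegrable (by fun_prop) _ _) ?_
    rintro r ⟨hr0, hrL⟩
    have hu : (1 - a) * L ≤ a * L + (1 - 2 * a) * r := by nlinarith
    have hu0 : 0 ≤ a * L + (1 - 2 * a) * r := le_trans (by positivity) hu
    have hg := hgrowth (a * r) _ hu0
    rw [show a * r + (a * L + (1 - 2 * a) * r) = a * L + (1 - a) * r by ring] at hg
    refine le_trans ?_ hg
    have hexp : Real.exp (2 * lam * (1 - a) * L)
        ≤ Real.exp (2 * lam * (a * L + (1 - 2 * a) * r)) := by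
      apply Real.exp_le_exp.mpr
      rw [mul_assoc (2 * lam)]
      gcongr
    have hφ := (hφpos (a * r)).le
    rw [hK]
    gcongr
  have hsplit := intervalIntegral.integral_add_adjacent_intervals
    (hφc.intervalIntegrable (μ := MeasureTheory.volume) 0 (a * L))
    (hφc.intervalIntegrable (a * L) L)
  have hden : 0 < a + (1 - a) * K := by positivity
  rw [mul_assoc (1 - a), ← hK, div_mul_eq_mul_div, div_le_iff₀ hden, ← hsplit, ← hhead, ← htail]
  have hscaled := mul_le_mul_of_nonneg_left hcompare (mul_pos ha0 hb0).le
  linarith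
end

section
/- For every t ≥ 0 one has max{m/M, 1 − t(M−m)/(Lm)} ∫_0^L ψ(s) ds ≤ ∫_t^{t+L} ψ(s) ds ≤ min{M/m, 1 + t(M−m)/(Lm)} ∫_0^L ψ(s) ds. -/
open MeasureTheory in
/-- A measurable function with values in `[m, M]` is interval integrable. -/
theorem intervalIntegrable_of_measurable_of_bounds {m M : ℝ} {ψ : ℝ → ℝ} (hmeas : Measurable ψ)
    (hbound : ∀ s, m ≤ ψ s ∧ ψ s ≤ M) (a b : ℝ) : IntervalIntegrable ψ volume a b :=
  (intervalIntegrable_const (c := max |m| |M|)).mono_fun hmeas.aestronglyMeasurable <|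
    .of_forall fun s => by
      simpa [abs_of_nonneg (le_max_of_le_left (abs_nonneg m))] using
        abs_le_max_abs_abs (hbound s).1 (hbound s).2

/-- The integral over `[a, b]` of a measurable function with values in `[m, M]` lies between
`m * (b - a)` and `M * (b - a)`. -/
theorem intervalIntegral_mem_Icc_of_bounds {m M : ℝ} {ψ : ℝ → ℝ} (hmeas : Measurable ψ)
    (hbound : ∀ s, m ≤ ψ s ∧ ψ s ≤ M) {a b : ℝ} (hab : a ≤ b) :
    m * (b - a) ≤ ∫ s in a..b, ψ s ∧ ∫ s in a..b, ψ s ≤ M * (b - a) := by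
  have hint := intervalIntegrable_of_measurable_of_bounds hmeas hbound a b
  constructor
  · simpa [mul_comm] using intervalIntegral.integral_mono hab intervalIntegrable_const hint
      fun s => (hbound s).1
  · simpa [mul_comm] using intervalIntegral.integral_mono hab hint intervalIntegrable_const
      fun s => (hbound s).2

/-- For a measurable `ψ` with `m ≤ ψ ≤ M` (`0 < m ≤ M`, `L > 0`)
and every `t ≥ 0`,
`max{m/M, 1 − t(M−m)/(Lm)} ∫_0^L ψ ≤ ∫_t^{t+L} ψ ≤ min{M/m, 1 + t(M−m)/(Lm)} ∫_0^L ψ`. -/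
theorem flow_direction_averaged_estimate
    (m M L : ℝ) (hm : 0 < m) (hmM : m ≤ M) (hL : 0 < L)
    (ψ : ℝ → ℝ) (hmeas : Measurable ψ)
    (hbound : ∀ s : ℝ, m ≤ ψ s ∧ ψ s ≤ M) :
    ∀ t : ℝ, 0 ≤ t →
      max (m / M) (1 - t * (M - m) / (L * m)) * (∫ s in (0:ℝ)..L, ψ s)
          ≤ (∫ s in t..(t + L), ψ s) ∧
      (∫ s in t..(t + L), ψ s)
          ≤ min (M / m) (1 + t * (M - m) / (L * m)) * (∫ s in (0:ℝ)..L, ψ s) := by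
  intro t ht
  have hint := intervalIntegrable_of_measurable_of_bounds hmeas hbound
  have hM : 0 < M := hm.trans_le hmM
  obtain ⟨h0l, h0u⟩ := intervalIntegral_mem_Icc_of_bounds hmeas hbound hL.le
  obtain ⟨h1l, h1u⟩ := intervalIntegral_mem_Icc_of_bounds hmeas hbound
    (show t ≤ t + L by linarith)
  obtain ⟨h2l, h2u⟩ := intervalIntegral_mem_Icc_of_bounds hmeas hbound ht
  obtain ⟨h3l, h3u⟩ := intervalIntegral_mem_Icc_of_bounds hmeas hbound
    (show L ≤ t + L by linarith)
  have hsplit := (intervalIntegral.integral_add_adjacent_intervals (hint 0 t)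
    (hint t (t + L))).trans (intervalIntegral.integral_add_adjacent_intervals (hint 0 L)
    (hint L (t + L))).symm
  set I₀ := ∫ s in (0:ℝ)..L, ψ s
  set I₁ := ∫ s in t..(t + L), ψ s
  have hI₀ : 0 ≤ I₀ := by nlinarith [mul_pos hm hL]
  have hA : t * (M - m) ≤ t * (M - m) / (L * m) * I₀ := by
    rw [div_mul_eq_mul_div, le_div_iff₀ (mul_pos hL hm)]
    exact mul_le_mul_of_nonneg_left (by linarith) (mul_nonneg ht (sub_nonneg.2 hmM))
  constructor
  · rw [max_mul_of_nonneg _ _ hI₀]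
    refine max_le ?_ (by linarith)
    rw [div_mul_eq_mul_div, div_le_iff₀ hM]
    nlinarith [mul_le_mul_of_nonneg_left h0u hm.le, mul_le_mul_of_nonneg_left h1l hM.le]
  · rw [min_mul_of_nonneg _ _ hI₀]
    refine le_min ?_ (by linarith)
    rw [div_mul_eq_mul_div, le_div_iff₀ hm]
    nlinarith [mul_le_mul_of_nonneg_left h1u hm.le, mul_le_mul_of_nonneg_left h0l hM.le]
end

section
/- For every σ > 0 and c, C ≥ 0 there exist ρ₀ > 0 and t₀ > 0 such that the following holds: for all t ∈ (0, t₀], all ρ ∈ (0, ρ₀], all vectors v_s, v_u, v_f ∈ H and every linear map A : H → H satisfying (i) ‖Av_s‖² ≥ e^{2σt}‖v_s‖², (ii) ‖Av_u‖² ≥ (1 − ct)‖v_u‖², (iii) ‖Av_f‖² ≥ (1 − ct)‖v_f‖², (iv) |⟨Ax, Ay⟩ − ⟨x, y⟩| ≤ Ct‖x‖‖y‖ for each pair (x,y) ∈ {(v_s,v_u), (v_s,v_f), (v_u,v_f)}, and (v) ‖v_u‖ + ‖v_f‖ ≤ ρ‖v_s‖, one has ‖A(v_s + v_u + v_f)‖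 ≥ e^{3σt/4}‖v_s + v_u + v_f‖. -/
open RealInnerProductSpace

/-- Hilbert-space core of the cone expansion estimate. For every `σ > 0`
and `c, C ≥ 0` there exist `ρ₀ > 0` and `t₀ > 0` such that for all `t ∈ (0,t₀]`,
`ρ ∈ (0,ρ₀]`, vectors `v_s, v_u, v_f` and linear maps `A` satisfying (i)–(v),
one has `‖A(v_s+v_u+v_f)‖ ≥ e^{3σt/4}‖v_s+v_u+v_f‖`. -/
theorem cone_expansion_core
    {H : Type*} [NormedAddCommGroup H] [InnerProductSpace ℝ H] :
    ∀ σ : ℝ, 0 < σ → ∀ c C : ℝ, 0 ≤ c → 0 ≤ C →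
      ∃ ρ₀ : ℝ, 0 < ρ₀ ∧ ∃ t₀ : ℝ, 0 < t₀ ∧
        ∀ t ∈ Set.Ioc (0 : ℝ) t₀, ∀ ρ ∈ Set.Ioc (0 : ℝ) ρ₀,
          ∀ (vs vu vf : H) (A : H →ₗ[ℝ] H),
            Real.exp (2 * σ * t) * ‖vs‖ ^ 2 ≤ ‖A vs‖ ^ 2 →
            (1 - c * t) * ‖vu‖ ^ 2 ≤ ‖A vu‖ ^ 2 →
            (1 - c * t) * ‖vf‖ ^ 2 ≤ ‖A vf‖ ^ 2 →
            |⟪A vs, A vu⟫ - ⟪vs, vu⟫| ≤ C * t * ‖vs‖ * ‖vu‖ →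
            |⟪A vs, A vf⟫ - ⟪vs, vf⟫| ≤ C * t * ‖vs‖ * ‖vf‖ →
            |⟪A vu, A vf⟫ - ⟪vu, vf⟫| ≤ C * t * ‖vu‖ * ‖vf‖ →
            ‖vu‖ + ‖vf‖ ≤ ρ * ‖vs‖ →
            Real.exp (3 * σ * t / 4) * ‖vs + vu + vf‖ ≤ ‖A (vs + vu + vf)‖ := by
  intro σ hσ c C hc hC
  have hD : 0 < 4 * (c + 4 * C + 6 * σ) := by positivity
  refine ⟨σ / (4 * (c + 4 * C + 6 * σ)), by positivity, 1 / (9 * σ), by positivity, ?_⟩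
  rintro t ⟨ht, ht'⟩ ρ ⟨hρ, hρ'⟩ vs vu vf A hs hu hf hsu hsf huf hcone
  rw [le_div_iff₀ hD] at hρ'
  rw [le_div_iff₀ (by positivity)] at ht'
  have hcρ : 0 ≤ c * ρ := by positivity
  have hCρ : 0 ≤ C * ρ := by positivity
  have hρ1 : ρ ≤ 1 := by
    have : σ * ρ ≤ σ * 1 := by linarith [mul_pos hσ hρ]
    exact le_of_mul_le_mul_left this hσ
  have hexp_lower : 2 * σ * t + 1 ≤ Real.exp (2 * σ * t) := Real.add_one_le_exp _
  have hexp_upper : Real.exp (3 * σ * t / 2) - 1 ≤ 7 / 4 * σ * t := by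
    have hx : 0 < 3 * σ * t / 2 := by positivity
    have h := Real.abs_exp_sub_one_sub_id_le (x := 3 * σ * t / 2)
      (by rw [abs_of_pos hx]; linarith)
    have := (abs_le.mp h).2
    nlinarith
  have hexp_sq : Real.exp (3 * σ * t / 4) ^ 2 = Real.exp (3 * σ * t / 2) := by
    rw [← Real.exp_nat_mul]
    congr 1
    push_cast
    ring
  have hexpand (x y z : H) : ‖x + y + z‖ ^ 2 =
      ‖x‖ ^ 2 + ‖y‖ ^ 2 + ‖z‖ ^ 2 + 2 * ⟪x, y⟫ + 2 * ⟪x, z⟫ + 2 * ⟪y, z⟫ := by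
    rw [norm_add_sq_real, norm_add_sq_real, inner_add_left]
    ring
  have hnorm : ‖vs + vu + vf‖ ≤ (1 + ρ) * ‖vs‖ := by
    have := norm_add₃_le (a := vs) (b := vu) (c := vf)
    linarith
  have hnorm_sq : ‖vs + vu + vf‖ ^ 2 ≤ (1 + 3 * ρ) * ‖vs‖ ^ 2 := by
    have := pow_le_pow_left₀ (norm_nonneg _) hnorm 2
    have : 0 ≤ ρ * (1 - ρ) * ‖vs‖ ^ 2 := by
      have := sub_nonneg.2 hρ1
      positivity
    linarith
  have hA := hexpand (A vs) (A vu) (A vf)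
  have hv := hexpand vs vu vf
  rw [← map_add, ← map_add] at hA
  replace hsu := (abs_le.mp hsu).1
  replace hsf := (abs_le.mp hsf).1
  replace huf := (abs_le.mp huf).1
  have ha := norm_nonneg vu
  have hb := norm_nonneg vf
  have hn := norm_nonneg vs
  generalize ‖vs‖ = s at *
  generalize ‖vu‖ = a at *
  generalize ‖vf‖ = b at *
  have hcone_sq : (a + b) ^ 2 ≤ ρ * s ^ 2 := by
    have h := pow_le_pow_left₀ (add_nonneg ha hb) hcone 2
    have : 0 ≤ ρ * (1 - ρ) * s ^ 2 := by
      have := sub_nonneg.2 hρ1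
      positivity
    linarith
  have hdiag : c * t * (a ^ 2 + b ^ 2) ≤ c * t * (ρ * s ^ 2) := by
    refine mul_le_mul_of_nonneg_left ?_ (by positivity)
    linarith [mul_nonneg ha hb, add_sq a b]
  have hcross : C * t * (s * a + s * b + a * b) ≤ C * t * (2 * ρ * s ^ 2) := by
    refine mul_le_mul_of_nonneg_left ?_ (by positivity)
    linarith [mul_nonneg ha hb, mul_le_mul_of_nonneg_left hcone hn, sq_nonneg a, sq_nonneg b,
      add_sq a b]
  have hgain : 2 * σ * t * s ^ 2 ≤ (Real.exp (2 * σ * t) - 1) * s ^ 2 :=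
    mul_le_mul_of_nonneg_right (by linarith) (sq_nonneg s)
  have hgrowth : (Real.exp (3 * σ * t / 2) - 1) * ‖vs + vu + vf‖ ^ 2 ≤
      7 / 4 * σ * t * ((1 + 3 * ρ) * s ^ 2) :=
    mul_le_mul hexp_upper hnorm_sq (sq_nonneg _) (by positivity)
  have hsmall : 7 / 4 * σ * t * ((1 + 3 * ρ) * s ^ 2) ≤
      2 * σ * t * s ^ 2 - c * t * (ρ * s ^ 2) - 2 * (C * t * (2 * ρ * s ^ 2)) := by
    have h : 0 ≤ (σ / 4 - (c + 4 * C + 21 / 4 * σ) * ρ) * (t * s ^ 2) := by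
      refine mul_nonneg ?_ (by positivity)
      linarith [mul_pos hσ hρ]
    linarith
  refine (sq_le_sq₀ (by positivity) (norm_nonneg _)).mp ?_
  rw [mul_pow, hexp_sq]
  linarith
end

section
/- Let ς > 0, t ∈ (0,1], ε ≥ 0 with εt ≤ 1/8, and ρ ∈ (0,1]. Suppose A : H → H is a linear map and v ∈ H satisfy: (i) ‖(I−Π)AΠw‖ ≤ εt‖w‖ and ‖ΠA(I−Π)w‖ ≤ εt‖w‖ for all w ∈ H; (ii) ‖A(I−Π)w‖ ≤ e^{ςt/2}‖(I−Π)w‖ for all w ∈ H; (iii) ‖AΠw‖ ≥ e^{ςt}‖Πw‖ for all w ∈ H; (iv) ‖(I−Π)v‖ ≤ ρ‖Πv‖. Then ‖(I−Π)Av‖ ≤ (e^{−ςt/2}ρ + 10 εt)‖ΠAv‖. -/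
open RealInnerProductSpace

/-- The complement of an orthogonal projection does not increase the norm. -/
theorem norm_sub_apply_le_of_idempotent_of_symmetric
    {H : Type*} [NormedAddCommGroup H] [InnerProductSpace ℝ H]
    (P : H →ₗ[ℝ] H) (hidem : ∀ w : H, P (P w) = P w)
    (hsa : ∀ w u : H, ⟪P w, u⟫ = ⟪w, P u⟫) (w : H) :
    ‖w - P w‖ ≤ ‖w‖ := by
  have h : ⟪w, P w⟫ = ‖P w‖ ^ 2 := by
    rw [← real_inner_self_eq_norm_sq, hsa, hidem]
  have h2 := norm_sub_sq_real w (P w)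
  rw [h] at h2
  exact le_of_sq_le_sq (by nlinarith [sq_nonneg ‖P w‖]) (norm_nonneg w)

/-- The scalar inequality behind the cone contraction, with `E = e^{ςt/2}` and `δ = εt`. -/
theorem cone_contraction_scalar {E δ ρ : ℝ} (hE : 1 ≤ E) (hδ₀ : 0 ≤ δ) (hδ : δ ≤ 1 / 8)
    (hρ₀ : 0 ≤ ρ) (hρ : ρ ≤ 1) :
    δ + E * ρ ≤ (E⁻¹ * ρ + 10 * δ) * (E ^ 2 - δ - δ * ρ) := by
  have hE0 : 0 < E := by linarith
  have hE1 : E⁻¹ * ρ ≤ 1 := mul_le_one₀ (inv_le_one_of_one_le₀ hE) hρ₀ hρ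
  have h0 : 0 ≤ E⁻¹ * ρ := by positivity
  have hcancel : E⁻¹ * ρ * E ^ 2 = E * ρ := by field_simp
  have hsum : (1 + ρ) * (E⁻¹ * ρ + 10 * δ) ≤ 2 * (9 / 4) :=
    mul_le_mul (by linarith) (by linarith) (by linarith) (by norm_num)
  have hfactor : 0 ≤ 10 * E ^ 2 - 1 - (1 + ρ) * (E⁻¹ * ρ + 10 * δ) := by
    nlinarith
  nlinarith [mul_nonneg hδ₀ hfactor]

/-- Hilbert-space core of the cone contraction estimate. `Π = P` is an
orthogonal projection (idempotent and self-adjoint); given `ς > 0`, `t ∈ (0,1]`,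
`ε ≥ 0` with `εt ≤ 1/8`, `ρ ∈ (0,1]`, a linear map `A` and vector `v` satisfying
(i)–(iv), one has `‖(I−Π)Av‖ ≤ (e^{−ςt/2}ρ + 10εt)‖ΠAv‖`. -/
theorem cone_contraction_core
    {H : Type*} [NormedAddCommGroup H] [InnerProductSpace ℝ H]
    (P : H →ₗ[ℝ] H)
    (hidem : ∀ w : H, P (P w) = P w)
    (hsa : ∀ w u : H, ⟪P w, u⟫ = ⟪w, P u⟫)
    (ς t ε ρ : ℝ)
    (hς : 0 < ς) (ht : t ∈ Set.Ioc (0 : ℝ) 1) (hε : 0 ≤ ε) (hεt : ε * t ≤ 1/8)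
    (hρ : ρ ∈ Set.Ioc (0 : ℝ) 1)
    (A : H →ₗ[ℝ] H) (v : H)
    (hi₁ : ∀ w : H, ‖A (P w) - P (A (P w))‖ ≤ ε * t * ‖w‖)
    (hi₂ : ∀ w : H, ‖P (A (w - P w))‖ ≤ ε * t * ‖w‖)
    (hii : ∀ w : H, ‖A (w - P w)‖ ≤ Real.exp (ς * t / 2) * ‖w - P w‖)
    (hiii : ∀ w : H, Real.exp (ς * t) * ‖P w‖ ≤ ‖A (P w)‖)
    (hiv : ‖v - P v‖ ≤ ρ * ‖P v‖) :
    ‖A v - P (A v)‖ ≤ (Real.exp (-(ς * t / 2)) * ρ + 10 * ε * t) * ‖P (A v)‖ := by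
  obtain ⟨hρ₀, hρ₁⟩ := hρ
  have hδ₀ : 0 ≤ ε * t := mul_nonneg hε ht.1.le
  have hE : 1 ≤ Real.exp (ς * t / 2) :=
    Real.one_le_exp (by have := mul_pos hς ht.1; linarith)
  have hE2 : Real.exp (ς * t) = Real.exp (ς * t / 2) ^ 2 := by
    rw [← Real.exp_nat_mul]; congr 1; push_cast; ring
  have hq : P (v - P v) = 0 := by rw [map_sub, hidem, sub_self]
  have hAp := hi₁ (P v)
  have hPAq := hi₂ (v - P v)
  have hAq := hii v
  have hlower := hiii (P v)
  rw [hidem] at hAp hlower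
  rw [hq, sub_zero] at hPAq
  rw [hE2] at hlower
  rw [Real.exp_neg, mul_assoc 10 ε t]
  have hscalar := cone_contraction_scalar hE hδ₀ hεt hρ₀.le hρ₁
  set E := Real.exp (ς * t / 2)
  set δ := ε * t
  have hsplit : A v = A (P v) + A (v - P v) := by rw [← map_add, add_sub_cancel]
  have hnum : ‖A v - P (A v)‖ ≤ (δ + E * ρ) * ‖P v‖ := by
    have hdecomp : A v - P (A v) =
        (A (P v) - P (A (P v))) + (A (v - P v) - P (A (v - P v))) := by
      rw [hsplit, map_add]; abel
    have hcompl := norm_sub_apply_le_of_idempotent_of_symmetric P hidem hsa (A (v - P v))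
    have htri := norm_add_le (A (P v) - P (A (P v))) (A (v - P v) - P (A (v - P v)))
    rw [← hdecomp] at htri
    have := mul_le_mul_of_nonneg_left hiv (show 0 ≤ E by linarith)
    linarith
  have hden : (E ^ 2 - δ - δ * ρ) * ‖P v‖ ≤ ‖P (A v)‖ := by
    have hPA : P (A v) = P (A (P v)) + P (A (v - P v)) := by rw [hsplit, map_add]
    have htri := norm_sub_le (P (A v)) (P (A (v - P v)))
    rw [show P (A v) - P (A (v - P v)) = P (A (P v)) by rw [hPA, add_sub_cancel_right]] at htri
    have hrev := norm_sub_norm_le (A (P v)) (P (A (P v)))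
    have := mul_le_mul_of_nonneg_left hiv hδ₀
    linarith
  calc ‖A v - P (A v)‖ ≤ (δ + E * ρ) * ‖P v‖ := hnum
    _ ≤ (E⁻¹ * ρ + 10 * δ) * (E ^ 2 - δ - δ * ρ) * ‖P v‖ := by gcongr
    _ = (E⁻¹ * ρ + 10 * δ) * ((E ^ 2 - δ - δ * ρ) * ‖P v‖) := mul_assoc _ _ _
    _ ≤ (E⁻¹ * ρ + 10 * δ) * ‖P (A v)‖ := by gcongr
end

section
/- For every ε > 0 and ϖ > 0 there exists N_ε > 0 (depending only on ε, ϖ, C and N∗) such that: for every ϱ ∈ (0,1), every map û : Ω → X with d(F_t^x(û(x)), û(τ_t x)) ≤ ϱ^{−ϖ} t for all x ∈ Ω and t ≥ 0, and every N ≥ N_ε (1 + ln(1/ϱ)), the map U : Ω → X defined by U(x) := F_N^{τ_{−N}x}(û(τ_{−N}x)) satisfies d(F_t^x(U(x)), U(τ_t x)) ≤ ε t for all x ∈ Ω and all t ≥ 0. -/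
/-- Exponential decay in `N` beats a negative power of `ϱ` once `N` exceeds a multiple of
`1 + log (1 / ϱ)`. -/
theorem exists_threshold_decay_mul_rpow_le {C Nstar ε ϖ : ℝ} (hC : 0 < C) (hNstar : 0 < Nstar)
    (hε : 0 < ε) (hϖ : 0 < ϖ) :
    ∃ Nε : ℝ, 0 < Nε ∧ ∀ ϱ ∈ Set.Ioo (0 : ℝ) 1, ∀ N : ℝ,
      Nε * (1 + Real.log (1 / ϱ)) ≤ N →
        0 ≤ N ∧ C * (2 : ℝ) ^ (-(N / Nstar)) * ϱ ^ (-ϖ) ≤ ε := by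
  have hlog2 : 0 < Real.log 2 := Real.log_pos one_lt_two
  set A := |Real.log C - Real.log ε| with hA
  have hA0 : 0 ≤ A := abs_nonneg _
  have hNε : 0 < Nstar / Real.log 2 * (A + ϖ) := by positivity
  refine ⟨Nstar / Real.log 2 * (A + ϖ), hNε, ?_⟩
  rintro ϱ ⟨hϱ0, hϱ1⟩ N hN
  rw [one_div, Real.log_inv] at hN
  have hL : 0 < -Real.log ϱ := neg_pos.mpr (Real.log_neg hϱ0 hϱ1)
  refine ⟨le_trans (by positivity) hN, ?_⟩
  have hexp : (A + ϖ) * (1 + -Real.log ϱ) ≤ Real.log 2 * (N / Nstar) := by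
    calc (A + ϖ) * (1 + -Real.log ϱ)
        = Real.log 2 * (Nstar / Real.log 2 * (A + ϖ) * (1 + -Real.log ϱ) / Nstar) := by
          field_simp
      _ ≤ Real.log 2 * (N / Nstar) := by gcongr
  rw [← Real.log_le_log_iff (by positivity) hε, Real.log_mul (by positivity) (by positivity),
    Real.log_mul (by positivity) (by positivity), Real.log_rpow two_pos, Real.log_rpow hϱ0]
  linarith [le_abs_self (Real.log C - Real.log ε), mul_nonneg hA0 hL.le]

/-- Lemma on approximate invariance of the smoothed distribution:
`τ` is a flow on `Ω`, `(X,d)` a metric space, `F_t^x : X → X` a cocycle over `τ`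
such that each `F_N^x` is Lipschitz with constant `C·2^{−N/N∗}`. For every `ε > 0`
and `ϖ > 0` there exists `N_ε > 0` such that for every `ϱ ∈ (0,1)` and every map `û`
with `d(F_t^x(û(x)), û(τ_t x)) ≤ ϱ^{−ϖ} t` for all `x`, `t ≥ 0`, and every
`N ≥ N_ε(1 + ln(1/ϱ))`, the map `U(x) := F_N^{τ_{−N}x}(û(τ_{−N}x))` satisfies
`d(F_t^x(U(x)), U(τ_t x)) ≤ ε t` for all `x`, `t ≥ 0`. -/
theorem pushforward_almost_invariance
    {Ω X : Type*} [MetricSpace X]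
    (τ : ℝ → Ω → Ω)
    (hτ0 : ∀ x, τ 0 x = x)
    (hτadd : ∀ s t : ℝ, ∀ x, τ (t + s) x = τ t (τ s x))
    (F : ℝ → Ω → X → X)
    (hcoc : ∀ s t : ℝ, 0 ≤ s → 0 ≤ t → ∀ (x : Ω) (a : X),
      F (t + s) x a = F t (τ s x) (F s x a))
    (C Nstar : ℝ) (hC : 0 < C) (hNstar : 0 < Nstar)
    (hlip : ∀ (x : Ω) (N : ℝ), 0 ≤ N → ∀ a b : X,
      dist (F N x a) (F N x b) ≤ C * (2 : ℝ) ^ (-(N / Nstar)) * dist a b) :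
    ∀ ε : ℝ, 0 < ε → ∀ ϖ : ℝ, 0 < ϖ →
      ∃ Nε : ℝ, 0 < Nε ∧
        ∀ ϱ ∈ Set.Ioo (0 : ℝ) 1, ∀ u : Ω → X,
          (∀ (x : Ω) (t : ℝ), 0 ≤ t → dist (F t x (u x)) (u (τ t x)) ≤ ϱ ^ (-ϖ) * t) →
          ∀ N : ℝ, Nε * (1 + Real.log (1 / ϱ)) ≤ N →
            ∀ (x : Ω) (t : ℝ), 0 ≤ t →
              dist (F t x (F N (τ (-N) x) (u (τ (-N) x))))
                   (F N (τ (-N) (τ t x)) (u (τ (-N) (τ t x)))) ≤ ε * t := by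
  intro ε hε ϖ hϖ
  obtain ⟨Nε, hNε, hdecay⟩ := exists_threshold_decay_mul_rpow_le hC hNstar hε hϖ
  refine ⟨Nε, hNε, fun ϱ hϱ u hu N hN x t ht => ?_⟩
  obtain ⟨hN0, hle⟩ := hdecay ϱ hϱ N hN
  have hback : τ N (τ (-N) x) = x := by rw [← hτadd, add_neg_cancel, hτ0]
  have hcomm : τ (-N) (τ t x) = τ t (τ (-N) x) := by rw [← hτadd, ← hτadd, add_comm]
  have hswap : F t x (F N (τ (-N) x) (u (τ (-N) x)))
      = F N (τ t (τ (-N) x)) (F t (τ (-N) x) (u (τ (-N) x))) := by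
    rw [← hcoc t N ht hN0, add_comm, hcoc N t hN0 ht, hback]
  rw [hcomm, hswap]
  calc _ ≤ C * (2 : ℝ) ^ (-(N / Nstar)) *
          dist (F t (τ (-N) x) (u (τ (-N) x))) (u (τ t (τ (-N) x))) := hlip _ _ hN0 _ _
    _ ≤ C * (2 : ℝ) ^ (-(N / Nstar)) * (ϱ ^ (-ϖ) * t) := by
        gcongr
        exact hu _ _ ht
    _ = C * (2 : ℝ) ^ (-(N / Nstar)) * ϱ ^ (-ϖ) * t := by ring
    _ ≤ ε * t := by gcongr
end

section
/- For every z ∈ ℂ with Re z > b, every integer m ≥ 1, every K > 0 and every h ∈ X, the Bochner integrals below converge and (1/(m−1)!) ∫_{3K}^{∞} t^{m−1} e^{−zt} L_t h dt = L_K ( (e^{−2Kz}/(m−1)!) ∫_{K}^{∞} (t+2K)^{m−1} e^{−zt} L_t (L_K h) dt ). -/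
open MeasureTheory

/-- Integrability on `[a, ∞)` of a polynomially weighted Laplace integrand of a strongly continuous
family with exponential growth bound. -/
lemma integrableOn_exp_mul_pow_smul_of_growth
    {X : Type*} [NormedAddCommGroup X] [NormedSpace ℂ X]
    (L : ℝ → X →L[ℂ] X) (hcont : ∀ h : X, Continuous fun t : ℝ => L t h)
    (M b : ℝ) (hgrowth : ∀ t : ℝ, 0 ≤ t → ‖L t‖ ≤ M * Real.exp (b * t))
    (z : ℂ) (hz : b < z.re) (n : ℕ) (a c : ℝ) (ha : 0 ≤ a) (hc : 0 ≤ c) (g : X) :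
    IntegrableOn (fun t : ℝ => (Complex.exp (-z * t) * ((t : ℂ) + c) ^ n) • L t g)
      (Set.Ici a) := by
  obtain ⟨ε, hε, hεz⟩ : ∃ ε : ℝ, 0 < ε ∧ z.re = b + 2 * ε :=
    ⟨(z.re - b) / 2, by linarith, by ring⟩
  have hdom : IntegrableOn (fun t : ℝ =>
      (n.factorial / ε ^ n * Real.exp (ε * c) * M * ‖g‖) * Real.exp (-ε * t)) (Set.Ici a) :=
    ((integrableOn_Ici_iff_integrableOn_Ioi (by finiteness)).mpr
      (exp_neg_integrableOn_Ioi a hε)).const_mul _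
  have hmeas : Continuous
      (fun t : ℝ => (Complex.exp (-z * t) * ((t : ℂ) + c) ^ n) • L t g) := by
    have := hcont g
    fun_prop
  refine Integrable.mono' hdom hmeas.aestronglyMeasurable ?_
  filter_upwards [ae_restrict_mem measurableSet_Ici] with t ht
  have ht0 : 0 ≤ t := ha.trans ht
  have hpow : (t + c) ^ n ≤ n.factorial / ε ^ n * Real.exp (ε * (t + c)) := by
    have h := Real.pow_div_factorial_le_exp (ε * (t + c)) (by positivity) n
    rw [div_le_iff₀ (by positivity), mul_pow] at h
    rw [div_mul_eq_mul_div, le_div_iff₀ (by positivity)]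
    linarith
  have hL : ‖L t g‖ ≤ M * Real.exp (b * t) * ‖g‖ :=
    (L t).le_of_opNorm_le (hgrowth t ht0) g
  have hexp : ‖Complex.exp (-z * t)‖ = Real.exp (-(z.re * t)) := by
    simp [Complex.norm_exp]
  have habs : ‖(t : ℂ) + c‖ = t + c := by
    rw [← Complex.ofReal_add, Complex.norm_of_nonneg (by positivity)]
  rw [norm_smul, norm_mul, norm_pow, hexp, habs]
  calc Real.exp (-(z.re * t)) * (t + c) ^ n * ‖L t g‖
      ≤ Real.exp (-(z.re * t)) * (n.factorial / ε ^ n * Real.exp (ε * (t + c))) *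
          (M * Real.exp (b * t) * ‖g‖) := by gcongr
    _ = (n.factorial / ε ^ n * M * ‖g‖) *
          (Real.exp (-(z.re * t)) * Real.exp (ε * (t + c)) * Real.exp (b * t)) := by ring
    _ = (n.factorial / ε ^ n * M * ‖g‖) * (Real.exp (ε * c) * Real.exp (-ε * t)) := by
      simp only [← Real.exp_add]
      congr 2
      rw [hεz]
      ring
    _ = _ := by ring

/-- factorization of the tail part `R_{K,m}(z)` of the resolvent power
through the time-`K` transfer operator on both sides. `(L_t)` is a strongly continuous
semigroup of bounded operators with `‖L_t‖ ≤ M e^{bt}`; for `Re z > b`, `m ≥ 1`, `K > 0`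
both Bochner integrals converge and
`(1/(m−1)!)∫_{3K}^∞ t^{m−1}e^{−zt}L_t h dt
  = L_K((e^{−2Kz}/(m−1)!)∫_K^∞ (t+2K)^{m−1}e^{−zt}L_t(L_K h) dt)`. -/
theorem resolvent_tail_factorization
    {X : Type*} [NormedAddCommGroup X] [NormedSpace ℂ X] [CompleteSpace X]
    (L : ℝ → X →L[ℂ] X)
    (hL0 : L 0 = ContinuousLinearMap.id ℂ X)
    (hLadd : ∀ s t : ℝ, 0 ≤ s → 0 ≤ t → L (t + s) = L t ∘L L s)
    (hcont : ∀ h : X, Continuous fun t : ℝ => L t h)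
    (M b : ℝ) (hM : 1 ≤ M)
    (hgrowth : ∀ t : ℝ, 0 ≤ t → ‖L t‖ ≤ M * Real.exp (b * t))
    (z : ℂ) (hz : b < z.re) (m : ℕ) (hm : 1 ≤ m) (K : ℝ) (hK : 0 < K) (h : X) :
    IntegrableOn
        (fun t : ℝ => (Complex.exp (-z * t) * (t : ℂ) ^ (m - 1)) • L t h)
        (Set.Ici (3 * K)) ∧
    IntegrableOn
        (fun t : ℝ => (Complex.exp (-z * t) * ((t : ℂ) + 2 * K) ^ (m - 1)) • L t (L K h))
        (Set.Ici K) ∧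
    ((↑(Nat.factorial (m - 1)) : ℂ)⁻¹) •
        (∫ t in Set.Ici (3 * K), (Complex.exp (-z * t) * (t : ℂ) ^ (m - 1)) • L t h)
      = L K ((Complex.exp (-(2 * K) * z) * ((↑(Nat.factorial (m - 1)) : ℂ)⁻¹)) •
          (∫ t in Set.Ici K,
            (Complex.exp (-z * t) * ((t : ℂ) + 2 * K) ^ (m - 1)) • L t (L K h))) := by
  have hint₁ := integrableOn_exp_mul_pow_smul_of_growth L hcont M b hgrowth z hz (m - 1)
    (3 * K) 0 (by positivity) le_rfl h
  have hint₂ := integrableOn_exp_mul_pow_smul_of_growth L hcont M b hgrowth z hz (m - 1)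
    K (2 * K) hK.le (by positivity) (L K h)
  simp only [Complex.ofReal_zero, add_zero] at hint₁
  simp only [Complex.ofReal_mul, Complex.ofReal_ofNat] at hint₂
  refine ⟨hint₁, hint₂, ?_⟩
  have hshift := (measurePreserving_add_right (volume : Measure ℝ) (2 * K)).setIntegral_preimage_emb
    (measurableEmbedding_addRight (2 * K))
    (fun t : ℝ => (Complex.exp (-z * t) * (t : ℂ) ^ (m - 1)) • L t h) (Set.Ici (3 * K))
  have hpre : (fun t : ℝ => t + 2 * K) ⁻¹' Set.Ici (3 * K) = Set.Ici K := by
    rw [Set.preimage_add_const_Ici]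
    congr 1
    ring
  rw [← hshift, hpre, map_smul, ← (L K).integral_comp_comm hint₂,
    mul_comm (Complex.exp (-(2 * K) * z)), mul_smul,
    ← integral_smul (Complex.exp (-(2 * K) * z))]
  congr 1
  refine setIntegral_congr_fun measurableSet_Ici fun t ht => ?_
  have ht0 : 0 ≤ t := hK.le.trans ht
  have hL : L (t + 2 * K) h = L K (L t (L K h)) := by
    rw [show t + 2 * K = K + (t + K) by ring, hLadd _ _ (by positivity) hK.le,
      hLadd _ _ hK.le ht0]
    rfl
  have hexp : Complex.exp (-z * ((t : ℂ) + 2 * K)) =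
      Complex.exp (-(2 * K) * z) * Complex.exp (-z * t) := by
    rw [← Complex.exp_add]
    ring_nf
  simp only [map_smul, hL, Complex.ofReal_add, Complex.ofReal_mul, Complex.ofReal_ofNat, hexp,
    smul_smul, mul_assoc]
end
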